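/- arXiv:1310.0847 — 4 statements merged into one kernel-verified Lean document; each statement's English description precedes it below -/
import Mathlib

section
/- Let n ≥ 1, d ≥ 1, and let Û_{i,j} ∈ [0,1] for i = 1,…,n and j = 1,…,d. Let w : [0,1]^d → ℝ be non-negative, bounded and Lebesgue integrable, and define μ₁(a) = ∫_{[a₁,1]×⋯×[a_d,1]} w(u) du, μ₂(a) = ∫_{[a₁,1]×⋯×[a_d,1]} (∏_{j=1}^d u_j) w(u) du for a ∈ [0,1]^d, and μ₃ = ∫_{[0,1]^d} (∏_{j=1}^d u_j²) w(u) du. Then the weighted Cramér–von Mises statistic satisfies W_n = Σ_{i=1}^n [ (1/n) Σ_{l=1}^n μ₁(Û_{i,1}∨Û_{l,1}, …, Û_{i,d}∨Û_{l,d}) − 2 μ₂(Û_{i,1}, …, Û_{i,d}) ] + n·μ₃, where ∨ denotes the maximum. -/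
open MeasureTheory Finset

/-- A product of coordinatewise comparison indicators is the indicator of an upper orthant. -/
theorem prod_ite_le_eq_indicator_Ici {ι : Type*} [Fintype ι] (a u : ι → ℝ) :
    (∏ j, if a j ≤ u j then (1 : ℝ) else 0) = (Set.Ici a).indicator (fun _ => 1) u := by
  classical
  simp [Finset.prod_ite_zero, Set.indicator_apply, Pi.le_def]

theorem setIntegral_Icc_eq_indicator_Ici {ι : Type*} [Fintype ι] {a b c : ι → ℝ} (h : c ≤ a)
    (f : (ι → ℝ) → ℝ) :
    ∫ u in Set.Icc a b, f u = ∫ u in Set.Icc c b, (Set.Ici a).indicator f u := by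
  rw [setIntegral_indicator measurableSet_Ici, Set.inter_comm, ← Set.Ici_inter_Iic,
    ← Set.Ici_inter_Iic, ← Set.inter_assoc, Set.Ici_inter_Ici, sup_eq_left.2 h]

/-- Proposition 1 (general closed form): for any non-negative, bounded, integrable
weight `w`, the weighted Cramér–von Mises statistic `Wₙ` can be computed from the
sample ranks via the maps `μ₁`, `μ₂`, `μ₃`. -/
theorem weighted_cvm_closed_form
    (n d : ℕ) (hn : 1 ≤ n) (hd : 1 ≤ d)
    (U : Fin n → Fin d → ℝ) (hU : ∀ i j, U i j ∈ Set.Icc (0 : ℝ) 1)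
    (w : (Fin d → ℝ) → ℝ)
    (hw_nonneg : ∀ u, 0 ≤ w u)
    (hw_bdd : ∃ Mb : ℝ, ∀ u, w u ≤ Mb)
    (hw_int : IntegrableOn w (Set.Icc (0 : Fin d → ℝ) 1) volume)
    (Cn : (Fin d → ℝ) → ℝ)
    (hCn : ∀ u, Cn u =
      (1 / n : ℝ) * ∑ i : Fin n, ∏ j : Fin d, if U i j ≤ u j then (1 : ℝ) else 0)
    (Wn : ℝ)
    (hWn : Wn = n * ∫ u in Set.Icc (0 : Fin d → ℝ) 1,
      (Cn u - ∏ j : Fin d, u j) ^ 2 * w u)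
    (μ1 μ2 : (Fin d → ℝ) → ℝ) (μ3 : ℝ)
    (hμ1 : ∀ a : Fin d → ℝ, μ1 a = ∫ u in Set.Icc a 1, w u)
    (hμ2 : ∀ a : Fin d → ℝ, μ2 a = ∫ u in Set.Icc a 1, (∏ j : Fin d, u j) * w u)
    (hμ3 : μ3 = ∫ u in Set.Icc (0 : Fin d → ℝ) 1, (∏ j : Fin d, (u j) ^ 2) * w u) :
    Wn = (∑ i : Fin n,
        ((1 / n : ℝ) * ∑ l : Fin n, μ1 (fun j => U i j ⊔ U l j)
          - 2 * μ2 (U i)))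
      + n * μ3 := by
  have hn0 : (n : ℝ) ≠ 0 := by positivity
  have hU0 (i : Fin n) : (0 : Fin d → ℝ) ≤ U i := fun j => (hU i j).1
  have hPw : IntegrableOn (fun u => (∏ j, u j) * w u) (Set.Icc (0 : Fin d → ℝ) 1) :=
    hw_int.continuousOn_mul (by fun_prop) isCompact_Icc
  have hP2w : IntegrableOn (fun u => (∏ j, u j ^ 2) * w u) (Set.Icc (0 : Fin d → ℝ) 1) :=
    hw_int.continuousOn_mul (by fun_prop) isCompact_Icc
  have hexpand (u : Fin d → ℝ) : (Cn u - ∏ j, u j) ^ 2 * w u =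
      (∑ i, ((1 / n : ℝ) ^ 2 * ∑ l, (Set.Ici (U i ⊔ U l)).indicator w u
        - 2 * (1 / n : ℝ) * (Set.Ici (U i)).indicator (fun u => (∏ j, u j) * w u) u))
      + (∏ j, u j ^ 2) * w u := by
    have h₁ (i l : Fin n) : (Set.Ici (U i ⊔ U l)).indicator w u =
        (Set.Ici (U i)).indicator (fun _ => (1 : ℝ)) u *
          (Set.Ici (U l)).indicator (fun _ => (1 : ℝ)) u * w u := by
      rw [← Set.Ici_inter_Ici]
      by_cases hi : U i ≤ u <;> by_cases hl : U l ≤ u <;> simp [hi, hl]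
    have h₂ (i : Fin n) : (Set.Ici (U i)).indicator (fun u => (∏ j, u j) * w u) u =
        (Set.Ici (U i)).indicator (fun _ => (1 : ℝ)) u * ((∏ j, u j) * w u) := by
      by_cases hi : U i ≤ u <;> simp [hi]
    simp only [hCn, prod_ite_le_eq_indicator_Ici, h₁, h₂, Finset.prod_pow,
      Finset.sum_sub_distrib, ← Finset.mul_sum, ← Finset.sum_mul]
    ring
  have hint₁ (i l : Fin n) : IntegrableOn ((Set.Ici (U i ⊔ U l)).indicator w)
      (Set.Icc (0 : Fin d → ℝ) 1) := hw_int.indicator measurableSet_Ici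
  have hint₂ (i : Fin n) : IntegrableOn
      ((Set.Ici (U i)).indicator (fun u => (∏ j, u j) * w u)) (Set.Icc (0 : Fin d → ℝ) 1) :=
    hPw.indicator measurableSet_Ici
  have hsum (i : Fin n) : IntegrableOn
      (fun u => (1 / n : ℝ) ^ 2 * ∑ l, (Set.Ici (U i ⊔ U l)).indicator w u)
      (Set.Icc (0 : Fin d → ℝ) 1) :=
    (integrable_finsetSum _ fun l _ => hint₁ i l).const_mul _
  have hterm (i : Fin n) : IntegrableOn
      (fun u => (1 / n : ℝ) ^ 2 * ∑ l, (Set.Ici (U i ⊔ U l)).indicator w u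
        - 2 * (1 / n : ℝ) * (Set.Ici (U i)).indicator (fun u => (∏ j, u j) * w u) u)
      (Set.Icc (0 : Fin d → ℝ) 1) :=
    (hsum i).sub ((hint₂ i).const_mul _)
  have hμ1' (i l : Fin n) : μ1 (fun j => U i j ⊔ U l j) =
      ∫ u in Set.Icc (0 : Fin d → ℝ) 1, (Set.Ici (U i ⊔ U l)).indicator w u :=
    (hμ1 _).trans (setIntegral_Icc_eq_indicator_Ici ((hU0 i).trans le_sup_left) w)
  have hμ2' (i : Fin n) : μ2 (U i) = ∫ u in Set.Icc (0 : Fin d → ℝ) 1,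
      (Set.Ici (U i)).indicator (fun u => (∏ j, u j) * w u) u :=
    (hμ2 _).trans (setIntegral_Icc_eq_indicator_Ici (hU0 i) _)
  simp only [hWn, hexpand]
  rw [integral_add (integrable_finsetSum _ fun i _ => hterm i) hP2w,
    integral_finsetSum _ fun i _ => hterm i, ← hμ3, mul_add, Finset.mul_sum]
  congr 1
  refine Finset.sum_congr rfl fun i _ => ?_
  rw [integral_sub (hsum i) ((hint₂ i).const_mul _), integral_const_mul, integral_const_mul,
    integral_finsetSum _ fun l _ => hint₁ i l, ← hμ2']
  simp only [hμ1']
  field_simp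
end

section
/- Let n ≥ 1, d ≥ 1, and let Û_{i,j} ∈ [0,1] for i = 1,…,n and j = 1,…,d. For the median weight function w_m(u) = ∏_{j=1}^d u_j(1 − u_j), the median-weighted statistic M_n = n ∫_{[0,1]^d} (C_n(u) − ∏_{j=1}^d u_j)² ∏_{j=1}^d u_j(1 − u_j) du satisfies M_n = Σ_{i=1}^n [ (1/n) Σ_{l=1}^n ∏_{j=1}^d (1/6)(2(Û_{i,j}∨Û_{l,j}) + 1)(Û_{i,j}∨Û_{l,j} − 1)² − 2 ∏_{j=1}^d ( (1/4)(Û_{i,j}⁴ − 1) + (1/3)(1 − Û_{i,j}³) ) ] + n·20^{-d}. -/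
open MeasureTheory Finset

/-- The integral over the unit cube of a product of one-variable functions factorizes. -/
lemma setIntegral_Icc_zero_one_prod {ι : Type*} [Fintype ι] (f : ι → ℝ → ℝ) :
    ∫ u in Set.Icc (0 : ι → ℝ) 1, ∏ j, f j (u j) = ∏ j, ∫ x in Set.Icc (0 : ℝ) 1, f j x := by
  rw [← Set.pi_univ_Icc, volume_pi, Measure.restrict_pi_pi, integral_fintype_prod_eq_prod]
  rfl

lemma integrableOn_Icc_zero_one_prod {ι : Type*} [Fintype ι] {f : ι → ℝ → ℝ}
    (hf : ∀ j, IntegrableOn (f j) (Set.Icc 0 1)) :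
    IntegrableOn (fun u : ι → ℝ ↦ ∏ j, f j (u j)) (Set.Icc 0 1) := by
  rw [IntegrableOn, ← Set.pi_univ_Icc, volume_pi, Measure.restrict_pi_pi]
  exact Integrable.fintype_prod hf

lemma integrableOn_ite_le_mul {g : ℝ → ℝ} (hg : Continuous g) (a : ℝ) :
    IntegrableOn (fun x ↦ (if a ≤ x then (1 : ℝ) else 0) * g x) (Set.Icc 0 1) := by
  have h : (fun x ↦ (if a ≤ x then (1 : ℝ) else 0) * g x) = (Set.Ici a).indicator g := by
    ext x
    simp [Set.indicator_apply]
  rw [h]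
  exact hg.integrableOn_Icc.indicator measurableSet_Ici

lemma setIntegral_Icc_ite_le_mul (g : ℝ → ℝ) {a : ℝ} (ha : a ∈ Set.Icc (0 : ℝ) 1) :
    ∫ x in Set.Icc (0 : ℝ) 1, (if a ≤ x then (1 : ℝ) else 0) * g x = ∫ x in a..1, g x := by
  have h : (fun x ↦ (if a ≤ x then (1 : ℝ) else 0) * g x) = (Set.Ici a).indicator g := by
    ext x
    simp [Set.indicator_apply]
  have hs : Set.Icc (0 : ℝ) 1 ∩ Set.Ici a = Set.Icc a 1 := by
    ext x
    simp only [Set.mem_inter_iff, Set.mem_Icc, Set.mem_Ici]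
    exact ⟨fun hx ↦ ⟨hx.2, hx.1.2⟩, fun hx ↦ ⟨⟨ha.1.trans hx.1, hx.2⟩, hx.1⟩⟩
  rw [h, setIntegral_indicator measurableSet_Ici, hs, integral_Icc_eq_integral_Ioc,
    intervalIntegral.integral_of_le ha.2]

lemma integral_pow_mul_one_sub (k : ℕ) (a : ℝ) :
    ∫ x in a..1, x ^ k * (1 - x) =
      (1 - a ^ (k + 1)) / (k + 1) - (1 - a ^ (k + 2)) / (k + 2) := by
  have h : ∀ x : ℝ, x ^ k * (1 - x) = x ^ k - x ^ (k + 1) := fun x ↦ by ring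
  simp_rw [h]
  rw [intervalIntegral.integral_sub (by simp) (by simp), integral_pow, integral_pow]
  push_cast
  ring

/-- Closed form of the median-weighted Cramér–von Mises statistic `Mₙ`
(weight `w(u) = ∏ⱼ uⱼ(1 − uⱼ)`). -/
theorem median_weighted_cvm_closed_form
    (n d : ℕ) (hn : 1 ≤ n) (hd : 1 ≤ d)
    (U : Fin n → Fin d → ℝ) (hU : ∀ i j, U i j ∈ Set.Icc (0 : ℝ) 1)
    (Cn : (Fin d → ℝ) → ℝ)
    (hCn : ∀ u, Cn u =
      (1 / n : ℝ) * ∑ i : Fin n, ∏ j : Fin d, if U i j ≤ u j then (1 : ℝ) else 0)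
    (Mn : ℝ)
    (hMn : Mn = n * ∫ u in Set.Icc (0 : Fin d → ℝ) 1,
      (Cn u - ∏ j : Fin d, u j) ^ 2 * ∏ j : Fin d, u j * (1 - u j)) :
    Mn = (∑ i : Fin n,
        ((1 / n : ℝ) * ∑ l : Fin n,
            ∏ j : Fin d, (1 / 6 : ℝ) * (2 * (U i j ⊔ U l j) + 1) * ((U i j ⊔ U l j) - 1) ^ 2
          - 2 * ∏ j : Fin d,
              ((1 / 4 : ℝ) * ((U i j) ^ 4 - 1) + (1 / 3 : ℝ) * (1 - (U i j) ^ 3))))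
      + n * ((20 : ℝ) ^ d)⁻¹ := by
  have hn0 : (n : ℝ) ≠ 0 := by
    have : n ≠ 0 := by omega
    exact_mod_cast this
  have hc (k : ℕ) : Continuous fun x : ℝ ↦ x ^ k * (1 - x) := by fun_prop
  have hpair (i l : Fin n) (j : Fin d) : U i j ⊔ U l j ∈ Set.Icc (0 : ℝ) 1 :=
    ⟨(hU i j).1.trans le_sup_left, sup_le (hU i j).2 (hU l j).2⟩
  set A : Fin n → Fin n → (Fin d → ℝ) → ℝ := fun i l u ↦
    ∏ j, (if U i j ⊔ U l j ≤ u j then (1 : ℝ) else 0) * (u j ^ 1 * (1 - u j)) with hA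
  set B : Fin n → (Fin d → ℝ) → ℝ := fun i u ↦
    ∏ j, (if U i j ≤ u j then (1 : ℝ) else 0) * (u j ^ 2 * (1 - u j)) with hB
  set D : (Fin d → ℝ) → ℝ := fun u ↦ ∏ j, u j ^ 3 * (1 - u j) with hD
  have hexpand (u : Fin d → ℝ) :
      (Cn u - ∏ j, u j) ^ 2 * ∏ j, u j * (1 - u j) =
        (1 / n : ℝ) ^ 2 * ∑ i, ∑ l, A i l u - 2 * (1 / n : ℝ) * ∑ i, B i u + D u := by
    have h1 (i l : Fin n) : A i l u = (∏ j, if U i j ≤ u j then (1 : ℝ) else 0) *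
        (∏ j, if U l j ≤ u j then (1 : ℝ) else 0) * ∏ j, u j * (1 - u j) := by
      simp only [hA, ← prod_mul_distrib]
      refine prod_congr rfl fun j _ ↦ ?_
      simp only [sup_le_iff]
      split_ifs <;> simp_all
    have h2 (i : Fin n) : B i u = (∏ j, if U i j ≤ u j then (1 : ℝ) else 0) *
        (∏ j, u j) * ∏ j, u j * (1 - u j) := by
      simp only [hB, ← prod_mul_distrib]
      exact prod_congr rfl fun j _ ↦ by ring
    have h3 : D u = (∏ j, u j) ^ 2 * ∏ j, u j * (1 - u j) := by
      simp only [hD, ← prod_mul_distrib, ← prod_pow]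
      exact prod_congr rfl fun j _ ↦ by ring
    simp only [h1, h2, h3, hCn, ← sum_mul, ← mul_sum]
    ring
  have hAi (i l : Fin n) : IntegrableOn (A i l) (Set.Icc 0 1) :=
    integrableOn_Icc_zero_one_prod
      (f := fun j x ↦ (if U i j ⊔ U l j ≤ x then (1 : ℝ) else 0) * (x ^ 1 * (1 - x)))
      fun j ↦ integrableOn_ite_le_mul (hc 1) _
  have hBi (i : Fin n) : IntegrableOn (B i) (Set.Icc 0 1) :=
    integrableOn_Icc_zero_one_prod
      (f := fun j x ↦ (if U i j ≤ x then (1 : ℝ) else 0) * (x ^ 2 * (1 - x)))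
      fun j ↦ integrableOn_ite_le_mul (hc 2) _
  have hDi : IntegrableOn D (Set.Icc 0 1) :=
    integrableOn_Icc_zero_one_prod (f := fun _ x ↦ x ^ 3 * (1 - x))
      fun _ ↦ (hc 3).integrableOn_Icc
  have hAv (i l : Fin n) : ∫ u in Set.Icc (0 : Fin d → ℝ) 1, A i l u =
      ∏ j, (1 / 6 : ℝ) * (2 * (U i j ⊔ U l j) + 1) * ((U i j ⊔ U l j) - 1) ^ 2 := by
    rw [hA, setIntegral_Icc_zero_one_prod
      (fun j x ↦ (if U i j ⊔ U l j ≤ x then (1 : ℝ) else 0) * (x ^ 1 * (1 - x)))]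
    refine prod_congr rfl fun j _ ↦ ?_
    rw [setIntegral_Icc_ite_le_mul (fun x ↦ x ^ 1 * (1 - x)) (hpair i l j),
      integral_pow_mul_one_sub]
    push_cast
    ring
  have hBv (i : Fin n) : ∫ u in Set.Icc (0 : Fin d → ℝ) 1, B i u =
      ∏ j, ((1 / 4 : ℝ) * ((U i j) ^ 4 - 1) + (1 / 3 : ℝ) * (1 - (U i j) ^ 3)) := by
    rw [hB, setIntegral_Icc_zero_one_prod
      (fun j x ↦ (if U i j ≤ x then (1 : ℝ) else 0) * (x ^ 2 * (1 - x)))]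
    refine prod_congr rfl fun j _ ↦ ?_
    rw [setIntegral_Icc_ite_le_mul (fun x ↦ x ^ 2 * (1 - x)) (hU i j),
      integral_pow_mul_one_sub]
    push_cast
    ring
  have hDv : ∫ u in Set.Icc (0 : Fin d → ℝ) 1, D u = ((20 : ℝ) ^ d)⁻¹ := by
    rw [hD, setIntegral_Icc_zero_one_prod (fun _ x ↦ x ^ 3 * (1 - x)),
      integral_Icc_eq_integral_Ioc, ← intervalIntegral.integral_of_le zero_le_one,
      integral_pow_mul_one_sub, prod_const, card_univ, Fintype.card_fin, ← inv_pow]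
    norm_num
  have hAs : IntegrableOn (fun u ↦ ∑ i, ∑ l, A i l u) (Set.Icc 0 1) :=
    integrable_finsetSum _ fun i _ ↦ integrable_finsetSum _ fun l _ ↦ hAi i l
  have hBs : IntegrableOn (fun u ↦ ∑ i, B i u) (Set.Icc 0 1) :=
    integrable_finsetSum _ fun i _ ↦ hBi i
  have hABs : IntegrableOn
      (fun u ↦ (1 / n : ℝ) ^ 2 * ∑ i, ∑ l, A i l u - 2 * (1 / n : ℝ) * ∑ i, B i u)
      (Set.Icc 0 1) := (hAs.const_mul _).sub (hBs.const_mul _)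
  rw [hMn]
  simp_rw [hexpand]
  rw [integral_add hABs hDi,
    integral_sub (hAs.const_mul _) (hBs.const_mul _), integral_const_mul, integral_const_mul,
    integral_finsetSum _ fun i _ ↦ integrable_finsetSum _ fun l _ ↦ hAi i l,
    integral_finsetSum _ fun i _ ↦ hBi i, hDv]
  simp_rw [integral_finsetSum _ fun l _ ↦ hAi _ l, hAv, hBv]
  rw [sum_sub_distrib, ← mul_sum, ← mul_sum]
  generalize (∑ i : Fin n, ∑ l : Fin n, ∏ j : Fin d,
    (1 / 6 : ℝ) * (2 * (U i j ⊔ U l j) + 1) * ((U i j ⊔ U l j) - 1) ^ 2) = a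
  generalize (∑ i : Fin n, ∏ j : Fin d,
    ((1 / 4 : ℝ) * ((U i j) ^ 4 - 1) + (1 / 3 : ℝ) * (1 - (U i j) ^ 3))) = b
  field_simp
end

section
/- Let n ≥ 1, d ≥ 1, and let Û_{i,j} ∈ [0,1] for i = 1,…,n and j = 1,…,d. For the lower-tail weight function w_l(u) = ∏_{j=1}^d (1 − u_j)², the lower-tail-weighted statistic L_n = n ∫_{[0,1]^d} (C_n(u) − ∏_{j=1}^d u_j)² ∏_{j=1}^d (1 − u_j)² du satisfies L_n = Σ_{i=1}^n [ (1/n) Σ_{l=1}^n ∏_{j=1}^d (1/3)(1 − Û_{i,j}∨Û_{l,j})³ − 2 ∏_{j=1}^d ( 1/12 − (1/4)Û_{i,j}⁴ + (2/3)Û_{i,j}³ − (1/2)Û_{i,j}² ) ] + n·30^{-d}. -/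
open MeasureTheory Finset

/-- The restriction of Lebesgue measure to the unit cube is a product measure. -/
lemma volume_restrict_unit_cube (d : ℕ) :
    (volume : Measure (Fin d → ℝ)).restrict (Set.Icc 0 1) =
      Measure.pi fun _ => (volume : Measure ℝ).restrict (Set.Icc 0 1) := by
  rw [← Measure.restrict_pi_pi, Set.pi_univ_Icc]
  rfl

lemma integrableOn_unit_cube_prod {d : ℕ} {f : Fin d → ℝ → ℝ}
    (hf : ∀ j, IntegrableOn (f j) (Set.Icc 0 1)) :
    IntegrableOn (fun u : Fin d → ℝ => ∏ j, f j (u j)) (Set.Icc 0 1) := by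
  rw [IntegrableOn, volume_restrict_unit_cube]
  exact Integrable.fintype_prod hf

lemma setIntegral_unit_cube_prod {d : ℕ} (f : Fin d → ℝ → ℝ) :
    ∫ u in Set.Icc (0 : Fin d → ℝ) 1, ∏ j, f j (u j) = ∏ j, ∫ x in Set.Icc (0 : ℝ) 1, f j x := by
  rw [volume_restrict_unit_cube]
  exact integral_fintype_prod_eq_prod f

lemma integrableOn_ite_le {g : ℝ → ℝ} (hg : Continuous g) (a : ℝ) :
    IntegrableOn (fun x => if a ≤ x then g x else 0) (Set.Icc 0 1) :=
  (hg.integrableOn_Icc (a := 0) (b := 1)).indicator (measurableSet_Ici (a := a))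

lemma setIntegral_ite_le {g : ℝ → ℝ} {a : ℝ} (ha : a ∈ Set.Icc (0 : ℝ) 1) :
    ∫ x in Set.Icc (0 : ℝ) 1, (if a ≤ x then g x else 0) = ∫ x in a..1, g x := by
  have h := setIntegral_indicator (μ := volume) (s := Set.Icc (0 : ℝ) 1) (f := g)
    (measurableSet_Ici (a := a))
  have hs : Set.Icc (0 : ℝ) 1 ∩ Set.Ici a = Set.Icc a 1 := by
    ext x
    simp only [Set.mem_inter_iff, Set.mem_Icc, Set.mem_Ici]
    exact ⟨fun h => ⟨h.2, h.1.2⟩, fun h => ⟨⟨ha.1.trans h.1, h.2⟩, h.1⟩⟩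
  rw [hs, integral_Icc_eq_integral_Ioc (x := a), ← intervalIntegral.integral_of_le ha.2] at h
  exact h

lemma integral_one_sub_sq (a : ℝ) :
    ∫ x in a..1, (1 - x) ^ 2 = (1 / 3 : ℝ) * (1 - a) ^ 3 := by
  have h : ∀ x ∈ Set.uIcc a 1,
      HasDerivAt (fun x : ℝ => x - x ^ 2 + x ^ 3 / 3) ((1 - x) ^ 2) x := fun x _ => by
    have := ((hasDerivAt_id x).sub (hasDerivAt_pow 2 x)).add ((hasDerivAt_pow 3 x).div_const 3)
    exact this.congr_deriv (by norm_num; ring)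
  rw [intervalIntegral.integral_eq_sub_of_hasDerivAt h
    (Continuous.intervalIntegrable (by fun_prop) _ _)]
  ring

lemma integral_mul_one_sub_sq (a : ℝ) :
    ∫ x in a..1, x * (1 - x) ^ 2 =
      (1 / 12 : ℝ) - (1 / 4 : ℝ) * a ^ 4 + (2 / 3 : ℝ) * a ^ 3 - (1 / 2 : ℝ) * a ^ 2 := by
  have h : ∀ x ∈ Set.uIcc a 1,
      HasDerivAt (fun x : ℝ => x ^ 2 / 2 - 2 / 3 * x ^ 3 + x ^ 4 / 4) (x * (1 - x) ^ 2) x :=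
    fun x _ => by
    have := (((hasDerivAt_pow 2 x).div_const 2).sub ((hasDerivAt_pow 3 x).const_mul (2 / 3))).add
      ((hasDerivAt_pow 4 x).div_const 4)
    exact this.congr_deriv (by norm_num; ring)
  rw [intervalIntegral.integral_eq_sub_of_hasDerivAt h
    (Continuous.intervalIntegrable (by fun_prop) _ _)]
  ring

lemma integral_sq_mul_one_sub_sq :
    ∫ x in Set.Icc (0 : ℝ) 1, x ^ 2 * (1 - x) ^ 2 = (30 : ℝ)⁻¹ := by
  have h : ∀ x ∈ Set.uIcc (0 : ℝ) 1,
      HasDerivAt (fun x : ℝ => x ^ 3 / 3 - 1 / 2 * x ^ 4 + x ^ 5 / 5) (x ^ 2 * (1 - x) ^ 2) x :=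
    fun x _ => by
    have := (((hasDerivAt_pow 3 x).div_const 3).sub ((hasDerivAt_pow 4 x).const_mul (1 / 2))).add
      ((hasDerivAt_pow 5 x).div_const 5)
    exact this.congr_deriv (by norm_num; ring)
  rw [integral_Icc_eq_integral_Ioc, ← intervalIntegral.integral_of_le zero_le_one,
    intervalIntegral.integral_eq_sub_of_hasDerivAt h
    (Continuous.intervalIntegrable (by fun_prop) _ _)]
  norm_num

/-- Expansion of the weighted square into products of functions of one coordinate. -/
lemma weighted_sq_expansion {n d : ℕ} (U : Fin n → Fin d → ℝ) (c : ℝ) (u : Fin d → ℝ) :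
    (c * (∑ i, ∏ j, if U i j ≤ u j then (1 : ℝ) else 0) - ∏ j, u j) ^ 2 * ∏ j, (1 - u j) ^ 2 =
      c ^ 2 * (∑ i, ∑ l, ∏ j, if U i j ⊔ U l j ≤ u j then (1 - u j) ^ 2 else 0)
        - 2 * c * (∑ i, ∏ j, if U i j ≤ u j then u j * (1 - u j) ^ 2 else 0)
        + ∏ j, u j ^ 2 * (1 - u j) ^ 2 := by
  have h1 : (∑ i, ∑ l, ∏ j, if U i j ⊔ U l j ≤ u j then (1 - u j) ^ 2 else 0) =
      (∑ i, ∏ j, if U i j ≤ u j then (1 : ℝ) else 0) ^ 2 * ∏ j, (1 - u j) ^ 2 := by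
    simp_rw [sq (∑ i, _), sum_mul_sum, sum_mul, ← prod_mul_distrib]
    refine sum_congr rfl fun i _ => sum_congr rfl fun l _ => prod_congr rfl fun j _ => ?_
    by_cases hi : U i j ≤ u j <;> by_cases hl : U l j ≤ u j <;> simp [hi, hl]
  have h2 : (∑ i, ∏ j, if U i j ≤ u j then u j * (1 - u j) ^ 2 else 0) =
      (∑ i, ∏ j, if U i j ≤ u j then (1 : ℝ) else 0) * ((∏ j, u j) * ∏ j, (1 - u j) ^ 2) := by
    simp_rw [sum_mul, ← prod_mul_distrib]
    refine sum_congr rfl fun i _ => prod_congr rfl fun j _ => ?_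
    split_ifs <;> simp
  have h3 : ∏ j, u j ^ 2 * (1 - u j) ^ 2 = (∏ j, u j) ^ 2 * ∏ j, (1 - u j) ^ 2 := by
    rw [prod_mul_distrib, prod_pow]
  rw [h1, h2, h3]
  ring

/-- Closed form of the lower-tail-weighted Cramér–von Mises statistic `Lₙ`
(weight `w(u) = ∏ⱼ (1 − uⱼ)²`). -/
theorem lower_tail_weighted_cvm_closed_form
    (n d : ℕ) (hn : 1 ≤ n) (hd : 1 ≤ d)
    (U : Fin n → Fin d → ℝ) (hU : ∀ i j, U i j ∈ Set.Icc (0 : ℝ) 1)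
    (Cn : (Fin d → ℝ) → ℝ)
    (hCn : ∀ u, Cn u =
      (1 / n : ℝ) * ∑ i : Fin n, ∏ j : Fin d, if U i j ≤ u j then (1 : ℝ) else 0)
    (Ln : ℝ)
    (hLn : Ln = n * ∫ u in Set.Icc (0 : Fin d → ℝ) 1,
      (Cn u - ∏ j : Fin d, u j) ^ 2 * ∏ j : Fin d, (1 - u j) ^ 2) :
    Ln = (∑ i : Fin n,
        ((1 / n : ℝ) * ∑ l : Fin n,
            ∏ j : Fin d, (1 / 3 : ℝ) * (1 - (U i j ⊔ U l j)) ^ 3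
          - 2 * ∏ j : Fin d,
              ((1 / 12 : ℝ) - (1 / 4 : ℝ) * (U i j) ^ 4 + (2 / 3 : ℝ) * (U i j) ^ 3
                - (1 / 2 : ℝ) * (U i j) ^ 2)))
      + n * ((30 : ℝ) ^ d)⁻¹ := by
  have hi1 (i l : Fin n) : IntegrableOn (fun u : Fin d → ℝ =>
      ∏ j, if U i j ⊔ U l j ≤ u j then (1 - u j) ^ 2 else 0) (Set.Icc 0 1) :=
    integrableOn_unit_cube_prod (f := fun j x => if U i j ⊔ U l j ≤ x then (1 - x) ^ 2 else 0)
      fun j => integrableOn_ite_le (g := fun x => (1 - x) ^ 2) (by fun_prop) _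
  have hi2 (i : Fin n) : IntegrableOn (fun u : Fin d → ℝ =>
      ∏ j, if U i j ≤ u j then u j * (1 - u j) ^ 2 else 0) (Set.Icc 0 1) :=
    integrableOn_unit_cube_prod (f := fun j x => if U i j ≤ x then x * (1 - x) ^ 2 else 0)
      fun j => integrableOn_ite_le (g := fun x => x * (1 - x) ^ 2) (by fun_prop) _
  have hi3 : IntegrableOn (fun u : Fin d → ℝ => ∏ j, u j ^ 2 * (1 - u j) ^ 2) (Set.Icc 0 1) :=
    Continuous.integrableOn_Icc (by fun_prop)
  have he1 (i l : Fin n) : ∫ u in Set.Icc (0 : Fin d → ℝ) 1,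
      (∏ j, if U i j ⊔ U l j ≤ u j then (1 - u j) ^ 2 else 0) =
      ∏ j, (1 / 3 : ℝ) * (1 - (U i j ⊔ U l j)) ^ 3 := by
    rw [setIntegral_unit_cube_prod fun j x => if U i j ⊔ U l j ≤ x then (1 - x) ^ 2 else 0]
    refine prod_congr rfl fun j _ => ?_
    rw [setIntegral_ite_le ⟨le_sup_of_le_left (hU i j).1, sup_le (hU i j).2 (hU l j).2⟩,
      integral_one_sub_sq]
  have he2 (i : Fin n) : ∫ u in Set.Icc (0 : Fin d → ℝ) 1,
      (∏ j, if U i j ≤ u j then u j * (1 - u j) ^ 2 else 0) =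
      ∏ j, ((1 / 12 : ℝ) - (1 / 4 : ℝ) * (U i j) ^ 4 + (2 / 3 : ℝ) * (U i j) ^ 3
        - (1 / 2 : ℝ) * (U i j) ^ 2) := by
    rw [setIntegral_unit_cube_prod fun j x => if U i j ≤ x then x * (1 - x) ^ 2 else 0]
    refine prod_congr rfl fun j _ => ?_
    rw [setIntegral_ite_le (hU i j), integral_mul_one_sub_sq]
  have he3 : ∫ u in Set.Icc (0 : Fin d → ℝ) 1, (∏ j, u j ^ 2 * (1 - u j) ^ 2) =
      ((30 : ℝ) ^ d)⁻¹ := by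
    rw [setIntegral_unit_cube_prod fun _ x => x ^ 2 * (1 - x) ^ 2]
    simp [integral_sq_mul_one_sub_sq]
  have hs1 := integrable_finsetSum univ fun i _ => integrable_finsetSum univ fun l _ => hi1 i l
  have hs2 := integrable_finsetSum univ fun i _ => hi2 i
  have hs12 : Integrable (fun u : Fin d → ℝ =>
      (1 / n : ℝ) ^ 2 * (∑ i, ∑ l, ∏ j, if U i j ⊔ U l j ≤ u j then (1 - u j) ^ 2 else 0)
        - 2 * (1 / n : ℝ) * (∑ i, ∏ j, if U i j ≤ u j then u j * (1 - u j) ^ 2 else 0))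
      (volume.restrict (Set.Icc 0 1)) :=
    (hs1.const_mul _).sub (hs2.const_mul _)
  have hn0 : (n : ℝ) ≠ 0 := by positivity
  simp_rw [hLn, hCn, weighted_sq_expansion]
  rw [integral_add hs12 hi3,
    integral_sub (hs1.const_mul _) (hs2.const_mul _), integral_const_mul, integral_const_mul,
    integral_finsetSum univ fun i _ => integrable_finsetSum univ fun l _ => hi1 i l,
    integral_finsetSum univ fun i _ => hi2 i]
  simp_rw [integral_finsetSum univ fun l _ => hi1 _ l, he1, he2, he3]
  rw [sum_sub_distrib, ← mul_sum, ← mul_sum]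
  field_simp
end

section
/- The bivariate Frank copula converges to the independence copula as its parameter tends to 0: for every (u₁,u₂) ∈ (0,1)², lim_{γ→0, γ≠0} −(1/γ) ln( 1 + (e^{−γu₁} − 1)(e^{−γu₂} − 1)/(e^{−γ} − 1) ) = u₁·u₂. -/
open Filter Topology

/-- The difference quotient of `γ ↦ exp (-γ * a)` at `0` tends to `-a`. -/
theorem tendsto_exp_neg_mul_sub_one_div (a : ℝ) :
    Tendsto (fun γ : ℝ => (Real.exp (-γ * a) - 1) / γ) (𝓝[≠] 0) (𝓝 (-a)) := by
  have h : HasDerivAt (fun γ : ℝ => Real.exp (-γ * a)) (-a) 0 := by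
    simpa using (((hasDerivAt_id (0 : ℝ)).neg.mul_const a).exp)
  refine h.tendsto_slope.congr fun γ => ?_
  simp [slope_def_field]

/-- The argument of the logarithm in the Frank copula, extended by `1` at `γ = 0`, has
derivative `-(u₁ * u₂)` there. -/
theorem hasDerivAt_frank_log_argument (u₁ u₂ : ℝ) :
    HasDerivAt (fun γ : ℝ => 1 +
      (Real.exp (-γ * u₁) - 1) * (Real.exp (-γ * u₂) - 1) / (Real.exp (-γ) - 1))
      (-(u₁ * u₂)) 0 := by
  rw [hasDerivAt_iff_tendsto_slope]
  have h := ((tendsto_exp_neg_mul_sub_one_div u₁).mul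
    (tendsto_exp_neg_mul_sub_one_div u₂)).div (tendsto_exp_neg_mul_sub_one_div 1) (by norm_num)
  have hlim : -u₁ * -u₂ / -1 = -(u₁ * u₂) := by ring
  rw [hlim] at h
  refine h.congr' ?_
  filter_upwards [self_mem_nhdsWithin] with γ hγ
  have hγ : γ ≠ 0 := hγ
  have hexp : Real.exp (-γ) - 1 ≠ 0 := by simpa [sub_eq_zero] using hγ
  simp only [Pi.div_apply, slope_def_field, mul_one, neg_zero, zero_mul, Real.exp_zero, sub_self,
    zero_div, add_zero, sub_zero, add_sub_cancel_left]
  field_simp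

/-- The bivariate Frank copula converges pointwise on `(0,1)²` to the independence
copula `u₁·u₂` as its parameter `γ` tends to `0` (through nonzero values). -/
theorem frank_copula_tendsto_independence :
    ∀ u₁ ∈ Set.Ioo (0 : ℝ) 1, ∀ u₂ ∈ Set.Ioo (0 : ℝ) 1,
      Tendsto (fun γ : ℝ =>
          -(1 / γ) * Real.log (1 +
            (Real.exp (-γ * u₁) - 1) * (Real.exp (-γ * u₂) - 1) / (Real.exp (-γ) - 1)))
        (𝓝[≠] (0 : ℝ)) (𝓝 (u₁ * u₂)) := by
  intro u₁ _ u₂ _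
  have h := ((hasDerivAt_frank_log_argument u₁ u₂).log (by simp)).tendsto_slope.neg
  simp only [neg_zero, zero_mul, Real.exp_zero, sub_self, zero_div, add_zero, div_one,
    neg_neg] at h
  refine h.congr fun γ => ?_
  simp only [slope_def_field, neg_zero, zero_mul, Real.exp_zero, sub_self, zero_div, add_zero,
    Real.log_one, sub_zero]
  ring
end
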